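/- Let λ ≥ 0 and let Z be a random variable with the Poisson distribution of parameter λ. Let f : ℕ → ℝ be a bounded function. Then for every n ∈ ℕ, Cov(f(Z), Z^n) = ∑_{k=0}^n λ^k · S(n,k) · (E[f(Z+k)] − E[f(Z)]), where Cov(F,G) = E[FG] − E[F]E[G] and S(n,k) denotes the Stirling number of the second kind. -/

import Mathlib

open MeasureTheory Finset

/-- Stirling number of the second kind: the number of partitions of a set of `n`
elements into `k` non-empty subsets. -/
noncomputable def stirling2 (n k : ℕ) : ℕ :=
  Nat.card {P : Finpartition (Finset.univ : Finset (Fin n)) // P.parts.card = k}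

/-- A function on `α` is determined by the partition of `α` into its fibres together with an
injective labelling of the fibres. -/
theorem bijective_sigma_finpartition_embedding {α β : Type*} [Fintype α] [DecidableEq α] :
    Function.Bijective
      fun (p : Σ P : Finpartition (univ : Finset α), P.parts ↪ β) (x : α) ↦
        p.2 ⟨p.1.part x, p.1.part_mem.2 (mem_univ x)⟩ := by
  constructor
  · rintro ⟨P, e⟩ ⟨Q, e'⟩ h
    have hrel (x y : α) : P.part x = P.part y ↔ Q.part x = Q.part y := by
      have hx := congrFun h x
      have hy := congrFun h y
      dsimp only at hx hy
      rw [← Subtype.mk.injEq (p := (· ∈ P.parts)) _ (P.part_mem.2 (mem_univ x)) _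
          (P.part_mem.2 (mem_univ y)),
        ← Subtype.mk.injEq (p := (· ∈ Q.parts)) _ (Q.part_mem.2 (mem_univ x)) _
          (Q.part_mem.2 (mem_univ y)), ← e.apply_eq_iff_eq, ← e'.apply_eq_iff_eq, hx, hy]
    have hpart (x : α) : P.part x = Q.part x := by
      ext y
      rw [P.mem_part_iff_part_eq_part (mem_univ y) (mem_univ x),
        Q.mem_part_iff_part_eq_part (mem_univ y) (mem_univ x), hrel]
    have mem_parts (R : Finpartition (univ : Finset α)) (t : Finset α) :
        t ∈ R.parts ↔ ∃ x, R.part x = t := by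
      constructor
      · intro ht
        obtain ⟨x, -, hx⟩ := R.part_surjOn ht
        exact ⟨x, hx⟩
      · rintro ⟨x, rfl⟩
        exact R.part_mem.2 (mem_univ x)
    obtain rfl : P = Q := by
      ext t
      simp only [mem_parts, hpart]
    congr 1
    ext ⟨t, ht⟩
    obtain ⟨x, rfl⟩ := (mem_parts P t).1 ht
    exact congrFun h x
  · intro g
    classical
    let P := Finpartition.ofSetoid (Setoid.ker g)
    have hP (x y : α) : y ∈ P.part x ↔ g x = g y := Finpartition.mem_part_ofSetoid_iff_rel
    have hne (t : P.parts) : ∃ x, P.part x = t := by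
      obtain ⟨x, -, hx⟩ := P.part_surjOn t.2
      exact ⟨x, hx⟩
    choose r hr using hne
    refine ⟨⟨P, fun t ↦ g (r t), fun t u htu ↦ ?_⟩, ?_⟩
    · have : r u ∈ P.part (r t) := (hP _ _).2 htu
      rw [P.mem_part_iff_part_eq_part (mem_univ _) (mem_univ _), hr, hr] at this
      exact Subtype.ext this.symm
    · funext x
      refine (hP _ _).1 ?_
      rw [hr]
      exact P.mem_part_self.2 (mem_univ x)

theorem pow_eq_sum_stirling2_mul_descFactorial (n m : ℕ) :
    m ^ n = ∑ k ∈ range (n + 1), stirling2 n k * m.descFactorial k := by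
  classical
  have hcard := Fintype.card_of_bijective
    (bijective_sigma_finpartition_embedding (α := Fin n) (β := Fin m))
  simp only [Fintype.card_sigma, Fintype.card_embedding_eq, Fintype.card_fun, Fintype.card_fin,
    Fintype.card_coe] at hcard
  rw [← hcard, ← sum_fiberwise_of_maps_to (t := range (n + 1))
    (g := fun P : Finpartition (univ : Finset (Fin n)) ↦ P.parts.card)]
  · refine sum_congr rfl fun k _ ↦ ?_
    rw [sum_congr rfl fun P hP ↦ by rw [(mem_filter.1 hP).2], sum_const, smul_eq_mul, stirling2,
      Nat.card_eq_fintype_card, Fintype.card_subtype]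
  · intro P _
    simpa [Nat.lt_succ_iff] using P.card_parts_le_card

namespace ProbabilityTheory

theorem hasSum_poissonMeasure_descFactorial_mul (r : NNReal) {g : ℕ → ℝ} (k : ℕ)
    (hg : Integrable (fun m ↦ g (m + k)) (poissonMeasure r)) :
    HasSum (fun m ↦ Real.exp (-r) * r ^ m / m.factorial * (m.descFactorial k * g m))
      (r ^ k * ∫ m, g (m + k) ∂poissonMeasure r) := by
  rw [← (add_left_injective k).hasSum_iff]
  · have := (hasSum_integral_poissonMeasure hg).mul_left ((r : ℝ) ^ k)
    refine (congrArg (HasSum · _) (funext fun m ↦ ?_)).mp this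
    have h : ((m + k).factorial : ℝ) = m.factorial * (m + k).descFactorial k := by
      have := Nat.factorial_mul_descFactorial (Nat.le_add_left k m)
      rw [Nat.add_sub_cancel] at this
      exact_mod_cast this.symm
    have h0 : ((m + k).descFactorial k : ℝ) ≠ 0 := by
      rw [Nat.cast_ne_zero, Ne, Nat.descFactorial_eq_zero_iff_lt]
      omega
    simp only [Function.comp_apply, h, smul_eq_mul]
    field_simp
    ring
  · intro m hm
    have hmk : m < k := by
      by_contra! h
      exact hm ⟨m - k, Nat.sub_add_cancel h⟩
    simp [Nat.descFactorial_eq_zero_iff_lt.2 hmk]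

/-- The Poisson moments of order `n`, weighted by a bounded function. -/
theorem integral_poissonMeasure_mul_pow (r : NNReal) {g : ℕ → ℝ} (hg : ∃ C, ∀ m, |g m| ≤ C)
    (n : ℕ) :
    ∫ m, g m * (m : ℝ) ^ n ∂poissonMeasure r =
      ∑ k ∈ range (n + 1),
        (r : ℝ) ^ k * (stirling2 n k : ℝ) * ∫ m, g (m + k) ∂poissonMeasure r := by
  obtain ⟨C, hC⟩ := hg
  rw [integral_poissonMeasure]
  have hsum := hasSum_sum fun k (_ : k ∈ range (n + 1)) ↦
    (hasSum_poissonMeasure_descFactorial_mul r k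
      (Integrable.of_bound .of_discrete C (.of_forall fun m ↦ hC (m + k)))).mul_left
      (stirling2 n k : ℝ)
  convert hsum.tsum_eq using 1
  · refine tsum_congr fun m ↦ ?_
    have hpow : (m : ℝ) ^ n = ∑ k ∈ range (n + 1), (stirling2 n k : ℝ) * m.descFactorial k := by
      exact_mod_cast pow_eq_sum_stirling2_mul_descFactorial n m
    rw [hpow, smul_eq_mul, mul_sum, mul_sum]
    exact sum_congr rfl fun k _ ↦ by ring
  · exact sum_congr rfl fun k _ ↦ by ring

end ProbabilityTheory

theorem stmt3 {Ω : Type*} [MeasurableSpace Ω] (μ : Measure Ω) [IsProbabilityMeasure μ]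
    (lam : ℝ) (hlam : 0 ≤ lam) (Z : Ω → ℕ) (hZ : Measurable Z)
    (hdist : ∀ m : ℕ, μ {ω | Z ω = m} =
      ENNReal.ofReal (Real.exp (-lam) * lam ^ m / Nat.factorial m))
    (f : ℕ → ℝ) (hf : ∃ C, ∀ m, |f m| ≤ C) (n : ℕ) :
    (∫ ω, f (Z ω) * (Z ω : ℝ) ^ n ∂μ) -
        (∫ ω, f (Z ω) ∂μ) * ∫ ω, (Z ω : ℝ) ^ n ∂μ =
      ∑ k ∈ Finset.range (n + 1),
        lam ^ k * (stirling2 n k : ℝ) *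
          ((∫ ω, f (Z ω + k) ∂μ) - ∫ ω, f (Z ω) ∂μ) := by
  lift lam to NNReal using hlam
  have hmap : μ.map Z = ProbabilityTheory.poissonMeasure lam := by
    refine Measure.ext_of_singleton fun m ↦ ?_
    rw [Measure.map_apply hZ (measurableSet_singleton m),
      ProbabilityTheory.poissonMeasure_singleton]
    exact hdist m
  have hint (g : ℕ → ℝ) :
      ∫ ω, g (Z ω) ∂μ = ∫ m, g m ∂ProbabilityTheory.poissonMeasure lam := by
    rw [← hmap, integral_map hZ.aemeasurable .of_discrete]
  have hmoment := ProbabilityTheory.integral_poissonMeasure_mul_pow lam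
    (g := fun _ ↦ 1) ⟨1, by simp⟩ n
  simp only [one_mul, integral_const, probReal_univ, smul_eq_mul, mul_one] at hmoment
  rw [hint fun m ↦ f m * (m : ℝ) ^ n, hint f, hint fun m ↦ (m : ℝ) ^ n, hmoment,
    ProbabilityTheory.integral_poissonMeasure_mul_pow lam hf n, mul_sum,
    ← sum_sub_distrib]
  refine sum_congr rfl fun k _ ↦ ?_
  rw [hint fun m ↦ f (m + k)]
  ring
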